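/- Let F ∈ ℂ[X] be a polynomial of degree n ≥ 1 that is injective on the open unit disk 𝔻, and let Ω = F(𝔻). Then for all z, w ∈ ℂ∖closure(Ω): E_Ω(z,w) = ( ∏_{ζ ∈ roots(F − z)} ( conj(F(1/conj(ζ))) − conj(w) ) ) / ( conj(F(0)) − conj(w) )^n, where roots(F − z) is the multiset of the n roots of the polynomial F − z counted with multiplicity (all of which are nonzero under the stated hypotheses). -/

import Mathlib

open MeasureTheory Polynomial

/-- The exponential transform of a bounded open set `Ω ⊆ ℂ`:
`E_Ω(z,w) = exp(−(1/π) ∫_Ω 1/((ζ−z)·conj(ζ−w)) dA(ζ))`. -/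
noncomputable def expTransform (Ω : Set ℂ) (z w : ℂ) : ℂ :=
  Complex.exp (-(1 / (Real.pi : ℂ)) *
    ∫ ζ in Ω, ((ζ - z) * (starRingEnd ℂ) (ζ - w))⁻¹)

open Metric Set ComplexConjugate

theorem setIntegral_unitBall_eq_integral_circleAverage {f : ℂ → ℂ}
    (hf : ContinuousOn f (closedBall 0 1)) :
    ∫ u in ball (0 : ℂ) 1, f u =
      ∫ r in (0 : ℝ)..1, (r : ℂ) * (2 * Real.pi * Real.circleAverage f 0 r) := by
  have hmap : Continuous fun p : ℝ × ℝ => circleMap 0 p.1 p.2 := by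
    unfold circleMap; fun_prop
  have hint : IntegrableOn (fun p : ℝ × ℝ => (p.1 : ℂ) * f (circleMap 0 p.1 p.2))
      (Ioo 0 1 ×ˢ Ioo (-Real.pi) Real.pi) (volume.prod volume) := by
    refine IntegrableOn.mono_set (t := Icc 0 1 ×ˢ Icc (-Real.pi) Real.pi) ?_
      (prod_mono Ioo_subset_Icc_self Ioo_subset_Icc_self)
    refine ContinuousOn.integrableOn_compact (isCompact_Icc.prod isCompact_Icc) ?_
    refine ContinuousOn.mul (by fun_prop) (hf.comp hmap.continuousOn ?_)
    rintro ⟨r, θ⟩ ⟨hr, -⟩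
    simpa [abs_of_nonneg hr.1] using hr.2
  calc
    ∫ u in ball (0 : ℂ) 1, f u = ∫ u, (ball (0 : ℂ) 1).indicator f u :=
      (integral_indicator measurableSet_ball).symm
    _ = ∫ p in polarCoord.target,
        (Ioo (0 : ℝ) 1 ×ˢ Ioo (-Real.pi) Real.pi).indicator
          (fun p : ℝ × ℝ => (p.1 : ℂ) * f (circleMap 0 p.1 p.2)) p := by
      rw [← Complex.integral_comp_polarCoord_symm]
      refine setIntegral_congr_fun polarCoord.open_target.measurableSet ?_
      rintro ⟨r, θ⟩ ⟨hr, hθ⟩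
      have hr0 : 0 < r := hr
      have hsymm : Complex.polarCoord.symm (r, θ) = circleMap 0 r θ := by
        simp [Complex.polarCoord_symm_apply, circleMap, Complex.exp_mul_I]
      have hθ' : θ ∈ Ioo (-Real.pi) Real.pi := hθ
      by_cases h1 : r < 1
      · simp [hsymm, abs_of_pos hr0, h1, hr0, hθ'.1, hθ'.2]
      · simp [hsymm, abs_of_pos hr0, h1]
    _ = ∫ p in Ioo (0 : ℝ) 1 ×ˢ Ioo (-Real.pi) Real.pi,
          (p.1 : ℂ) * f (circleMap 0 p.1 p.2) := by
      rw [setIntegral_indicator (measurableSet_Ioo.prod measurableSet_Ioo),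
        inter_eq_self_of_subset_right]
      exact prod_mono (fun _ h => h.1) subset_rfl
    _ = ∫ r in Ioo (0 : ℝ) 1, ∫ θ in Ioo (-Real.pi) Real.pi, (r : ℂ) * f (circleMap 0 r θ) := by
      rw [Measure.volume_eq_prod, setIntegral_prod _ hint]
    _ = ∫ r in Ioo (0 : ℝ) 1, (r : ℂ) * (2 * Real.pi * Real.circleAverage f 0 r) := by
      congr 1 with r
      rw [integral_const_mul, ← integral_Ioc_eq_integral_Ioo,
        ← intervalIntegral.integral_of_le (by linarith [Real.pi_pos]), Real.circleAverage_def]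
      have hper : Function.Periodic (fun θ => f (circleMap 0 r θ)) (2 * Real.pi) :=
        (periodic_circleMap 0 r).comp f
      have := hper.intervalIntegral_add_eq (-Real.pi) 0
      rw [show -Real.pi + 2 * Real.pi = Real.pi by ring, zero_add] at this
      rw [this]
      have : (Real.pi : ℂ) ≠ 0 := by exact_mod_cast Real.pi_ne_zero
      simp only [Complex.real_smul]
      push_cast
      field_simp
    _ = _ := by
      rw [← integral_Ioc_eq_integral_Ioo, ← intervalIntegral.integral_of_le zero_le_one]

theorem circleAverage_inv_sub_mul_conj_inv_sub {a b : ℂ} (ha : 1 < ‖a‖) (hb : 1 < ‖b‖)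
    {r : ℝ} (hr0 : 0 < r) (hr1 : r ≤ 1) :
    Real.circleAverage (fun u => (u - a)⁻¹ * conj ((u - b)⁻¹)) 0 r =
      (a * conj b - (r : ℂ) ^ 2)⁻¹ := by
  have hb0 : conj b ≠ 0 := by
    rw [Ne, map_eq_zero, ← norm_eq_zero]; linarith
  set c : ℂ := (r : ℂ) ^ 2 / conj b with hc
  have hcr : ‖c‖ < r := by
    rw [hc, norm_div, norm_pow, Complex.norm_real, RCLike.norm_conj, Real.norm_of_nonneg hr0.le,
      div_lt_iff₀ (by linarith)]
    nlinarith
  have hne : ∀ u ∈ closedBall (0 : ℂ) r, u - a ≠ 0 := by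
    intro u hu h
    rw [sub_eq_zero.1 h, mem_closedBall_zero_iff] at hu
    linarith
  have hdiff : ∀ u ∈ closedBall (0 : ℂ) r,
      DifferentiableAt ℂ (fun u => -(conj b)⁻¹ * (u - a)⁻¹) u := fun u hu => by
    have := hne u hu
    fun_prop (disch := assumption)
  have key := Complex.circleIntegral_sub_inv_smul_of_differentiable_on_off_countable
    (c := 0) (R := r) (w := c) (f := fun u => -(conj b)⁻¹ * (u - a)⁻¹) countable_empty
    (by simpa using hcr) (fun u hu => (hdiff u hu).continuousAt.continuousWithinAt)
    (fun u hu => hdiff u (ball_subset_closedBall hu.1))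
  rw [Real.circleAverage_eq_circleIntegral hr0.ne']
  have hcongr : (∮ u in C(0, r), (u - 0)⁻¹ • ((u - a)⁻¹ * conj ((u - b)⁻¹))) =
      ∮ u in C(0, r), (u - c)⁻¹ • (-(conj b)⁻¹ * (u - a)⁻¹) := by
    refine circleIntegral.integral_congr hr0.le fun u hu => ?_
    rw [mem_sphere_zero_iff_norm] at hu
    have hu0 : u ≠ 0 := by rw [← norm_pos_iff, hu]; exact hr0
    have hcu : conj u = (r : ℂ) ^ 2 / u := by
      rw [eq_div_iff hu0, mul_comm, Complex.mul_conj, Complex.normSq_eq_norm_sq, hu]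
      push_cast; rfl
    have h1 : u - c ≠ 0 := by
      intro h
      rw [← sub_eq_zero.1 h, hu] at hcr
      exact lt_irrefl _ hcr
    simp only [smul_eq_mul, sub_zero, map_inv₀, map_sub, hcu]
    have h2 : (r : ℂ) ^ 2 / u - conj b = -(conj b * (u - c) / u) := by
      rw [hc]; field_simp; ring
    rw [h2]
    have := hne u (by simp [hu])
    field_simp
  rw [hcongr, key, smul_smul, inv_mul_cancel₀ Complex.two_pi_I_ne_zero, one_smul, neg_mul,
    ← mul_inv, ← inv_neg]
  congr 1
  rw [hc]
  field_simp
  ring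

theorem exp_integral_unitBall_inv_sub_mul_conj_inv_sub {a b : ℂ} (ha : 1 < ‖a‖) (hb : 1 < ‖b‖)
    (hf : ContinuousOn (fun u => (u - a)⁻¹ * conj ((u - b)⁻¹)) (closedBall 0 1)) :
    Complex.exp (-(1 / (Real.pi : ℂ)) *
      ∫ u in ball (0 : ℂ) 1, (u - a)⁻¹ * conj ((u - b)⁻¹)) = 1 - 1 / (a * conj b) := by
  set m : ℂ := a * conj b with hm
  have hm1 : 1 < ‖m‖ := by
    rw [hm, norm_mul, RCLike.norm_conj]
    nlinarith
  have hm0 : m ≠ 0 := by rw [← norm_pos_iff]; linarith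
  have hslit : ∀ r ∈ Icc (0 : ℝ) 1, 1 - (r : ℂ) ^ 2 / m ∈ Complex.slitPlane := by
    intro r hr
    rw [sub_eq_add_neg]
    apply Complex.mem_slitPlane_of_norm_lt_one
    rw [norm_neg, norm_div, norm_pow, Complex.norm_real, Real.norm_of_nonneg hr.1,
      div_lt_one (by linarith)]
    nlinarith [hr.1, hr.2]
  have hsub : ∀ r ∈ Icc (0 : ℝ) 1, m - (r : ℂ) ^ 2 ≠ 0 := by
    intro r hr h
    apply Complex.slitPlane_ne_zero (hslit r hr)
    rw [← sub_eq_zero.1 h, div_self hm0, sub_self]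
  have hderiv : ∀ r ∈ uIcc (0 : ℝ) 1,
      HasDerivAt (fun r : ℝ => -(Real.pi : ℂ) * Complex.log (1 - (r : ℂ) ^ 2 / m))
        ((r : ℂ) * (2 * Real.pi * (m - (r : ℂ) ^ 2)⁻¹)) r := by
    intro r hr
    rw [uIcc_of_le zero_le_one] at hr
    have h1 : HasDerivAt (fun r : ℝ => 1 - (r : ℂ) ^ 2 / m) (-(2 * (r : ℂ) / m)) r := by
      have h0 := (((Complex.ofRealCLM.hasDerivAt (x := r)).pow 2).div_const m).const_sub 1
      simpa using h0
    refine ((h1.clog_real (hslit r hr)).const_mul (-(Real.pi : ℂ))).congr_deriv ?_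
    have h2 := hsub r hr
    have h3 := Complex.slitPlane_ne_zero (hslit r hr)
    have h4 : 1 - (r : ℂ) ^ 2 / m = (m - (r : ℂ) ^ 2) / m := by field_simp
    rw [h4]
    field_simp
  have hcont : ContinuousOn (fun r : ℝ => (r : ℂ) * (2 * Real.pi * (m - (r : ℂ) ^ 2)⁻¹))
      (uIcc 0 1) := by
    intro r hr
    rw [uIcc_of_le zero_le_one] at hr
    have := hsub r hr
    apply ContinuousAt.continuousWithinAt
    fun_prop (disch := assumption)
  have hint : ∫ u in ball (0 : ℂ) 1, (u - a)⁻¹ * conj ((u - b)⁻¹) =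
      -(Real.pi : ℂ) * Complex.log (1 - 1 / m) := by
    rw [setIntegral_unitBall_eq_integral_circleAverage hf]
    have hcongr : ∀ r ∈ uIoo (0 : ℝ) 1,
        (r : ℂ) * (2 * Real.pi * Real.circleAverage
          (fun u => (u - a)⁻¹ * conj ((u - b)⁻¹)) 0 r) =
        (r : ℂ) * (2 * Real.pi * (m - (r : ℂ) ^ 2)⁻¹) := by
      intro r hr
      rw [uIoo_of_le zero_le_one] at hr
      rw [circleAverage_inv_sub_mul_conj_inv_sub ha hb hr.1 hr.2.le]
    rw [intervalIntegral.integral_congr_uIoo hcongr,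
      intervalIntegral.integral_eq_sub_of_hasDerivAt hderiv hcont.intervalIntegrable]
    simp
  have hpi : (Real.pi : ℂ) ≠ 0 := by exact_mod_cast Real.pi_ne_zero
  rw [hint, show -(1 / (Real.pi : ℂ)) * (-(Real.pi : ℂ) * Complex.log (1 - 1 / m)) =
    Complex.log (1 - 1 / m) by field_simp, Complex.exp_log]
  simpa using Complex.slitPlane_ne_zero (hslit 1 (by simp))

theorem exp_mul_integral_multiset_sum {α : Type*} [MeasurableSpace α] {μ : Measure α} {ι : Type*}
    (c : ℂ) (S : Multiset ι) (φ : ι → α → ℂ) (hφ : ∀ i ∈ S, Integrable (φ i) μ) :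
    Complex.exp (c * ∫ x, (S.map fun i => φ i x).sum ∂μ) =
      (S.map fun i => Complex.exp (c * ∫ x, φ i x ∂μ)).prod := by
  have key : Integrable (fun x => (S.map fun i => φ i x).sum) μ ∧
      Complex.exp (c * ∫ x, (S.map fun i => φ i x).sum ∂μ) =
        (S.map fun i => Complex.exp (c * ∫ x, φ i x ∂μ)).prod := by
    induction S using Multiset.induction_on with
    | empty => simp
    | cons i S ih =>
      obtain ⟨h1, h2⟩ := ih fun j hj => hφ j (Multiset.mem_cons_of_mem hj)
      have h3 := hφ i (Multiset.mem_cons_self i S)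
      simp only [Multiset.map_cons, Multiset.sum_cons, Multiset.prod_cons]
      exact ⟨h3.add h1, by rw [integral_add h3 h1, mul_add, Complex.exp_add, h2]⟩
  exact key.2

theorem continuousOn_inv_sub_closedBall {a : ℂ} (ha : 1 < ‖a‖) :
    ContinuousOn (fun u : ℂ => (u - a)⁻¹) (closedBall 0 1) := by
  refine (continuousOn_id.sub continuousOn_const).inv₀ fun u hu h => ?_
  rw [mem_closedBall_zero_iff, sub_eq_zero.1 (show u - a = 0 from h)] at hu
  linarith

theorem sum_map_product_eq_sum_sum {α β M : Type*} [AddCommMonoid M] (s : Multiset α)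
    (t : Multiset β) (f : α × β → M) :
    ((s ×ˢ t).map f).sum = (s.map fun i => (t.map fun j => f (i, j)).sum).sum := by
  induction s using Multiset.induction <;> simp_all

theorem exp_integral_unitBall_sum_mul_conj_sum {S T : Multiset ℂ} (hS : ∀ a ∈ S, 1 < ‖a‖)
    (hT : ∀ b ∈ T, 1 < ‖b‖) :
    Complex.exp (-(1 / (Real.pi : ℂ)) * ∫ u in ball (0 : ℂ) 1,
      (S.map fun a => 1 / (u - a)).sum * conj (T.map fun b => 1 / (u - b)).sum) =
      (S.map fun a => (T.map fun b => 1 - 1 / (a * conj b)).prod).prod := by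
  have hcont : ∀ a ∈ S, ∀ b ∈ T,
      ContinuousOn (fun u => (u - a)⁻¹ * conj ((u - b)⁻¹)) (closedBall 0 1) :=
    fun a ha b hb => (continuousOn_inv_sub_closedBall (hS a ha)).mul
      (Complex.continuous_conj.comp_continuousOn (continuousOn_inv_sub_closedBall (hT b hb)))
  have hint : ∀ p ∈ S ×ˢ T, IntegrableOn (fun u => (u - p.1)⁻¹ * conj ((u - p.2)⁻¹))
      (ball (0 : ℂ) 1) := fun p hp => by
    rw [Multiset.mem_product] at hp
    exact ((hcont _ hp.1 _ hp.2).integrableOn_compact (isCompact_closedBall 0 1)).mono_set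
      ball_subset_closedBall
  have hsum : ∀ u : ℂ,
      (S.map fun a => 1 / (u - a)).sum * conj (T.map fun b => 1 / (u - b)).sum =
        ((S ×ˢ T).map fun p => (u - p.1)⁻¹ * conj ((u - p.2)⁻¹)).sum := fun u => by
    rw [sum_map_product_eq_sum_sum, map_multiset_sum, Multiset.map_map]
    simp [Multiset.sum_map_mul_right, Multiset.sum_map_mul_left]
  simp only [hsum]
  rw [exp_mul_integral_multiset_sum _ _ _ hint, Multiset.prod_map_product_eq_prod_prod]
  refine congrArg _ (Multiset.map_congr rfl fun a ha => ?_)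
  refine congrArg _ (Multiset.map_congr rfl fun b hb => ?_)
  exact exp_integral_unitBall_inv_sub_mul_conj_inv_sub (hS a ha) (hT b hb) (hcont a ha b hb)

theorem det_restrictScalars_toSpanSingleton (c : ℂ) :
    ((ContinuousLinearMap.toSpanSingleton ℂ c).restrictScalars ℝ).det = ‖c‖ ^ 2 := by
  have := Algebra.norm_complex_apply c
  rw [Algebra.norm_apply] at this
  rw [ContinuousLinearMap.det, ← Complex.normSq_eq_norm_sq, ← this]
  congr 1
  ext
  simp [mul_comm]

theorem setIntegral_polynomial_image {F : ℂ[X]} {s : Set ℂ} (hs : MeasurableSet s)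
    (hinj : InjOn (fun ζ => F.eval ζ) s) (g : ℂ → ℂ) :
    ∫ ζ in (fun ζ => F.eval ζ) '' s, g ζ =
      ∫ u in s, F.derivative.eval u * conj (F.derivative.eval u) * g (F.eval u) := by
  rw [integral_image_eq_integral_abs_det_fderiv_smul volume hs
    (fun u _ => (F.hasDerivAt u).hasFDerivAt.restrictScalars ℝ |>.hasFDerivWithinAt) hinj]
  congr 1 with u
  rw [Complex.mul_conj, Complex.normSq_eq_norm_sq]
  erw [det_restrictScalars_toSpanSingleton]
  simp

theorem one_lt_norm_of_mem_roots_sub_C {F : ℂ[X]} {z : ℂ}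
    (hz : z ∉ closure ((fun ζ => F.eval ζ) '' ball (0 : ℂ) 1)) :
    ∀ a ∈ (F - C z).roots, 1 < ‖a‖ := by
  intro a ha
  by_contra! h
  apply hz
  have hroot : F.eval a = z := by
    have := (mem_roots'.1 ha).2
    simpa [IsRoot, sub_eq_zero] using this
  rw [← hroot]
  refine image_closure_subset_closure_image F.continuous (mem_image_of_mem _ ?_)
  rw [closure_ball _ one_ne_zero]
  simpa using h

/-- The exponential transform of a simply connected quadrature domain `Ω = F(𝔻)`,
`F` a polynomial univalent on the unit disk, as the meromorphic resultant
`Res_u(F(u) − z, F*(u) − w̄)`: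
`E_Ω(z,w) = ∏_{ζ ∈ roots(F−z)} (conj(F(1/ζ̄)) − w̄) / (conj(F(0)) − w̄)ⁿ`. -/
theorem expTransform_polynomial_image (F : Polynomial ℂ) (n : ℕ) (hn : 1 ≤ n)
    (hdeg : F.natDegree = n)
    (hinj : Set.InjOn (fun ζ => F.eval ζ) (Metric.ball (0:ℂ) 1))
    (Ω : Set ℂ) (hΩ : Ω = (fun ζ => F.eval ζ) '' Metric.ball (0:ℂ) 1)
    (z w : ℂ) (hz : z ∉ closure Ω) (hw : w ∉ closure Ω) :
    expTransform Ω z w =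
      (((F - Polynomial.C z).roots.map (fun ζ =>
          (starRingEnd ℂ) (F.eval (1 / (starRingEnd ℂ) ζ)) - (starRingEnd ℂ) w)).prod) /
        ((starRingEnd ℂ) (F.eval 0) - (starRingEnd ℂ) w) ^ n := by
  subst hΩ hdeg
  have hmem : ∀ u ∈ ball (0 : ℂ) 1, ∀ v, v ∉ closure ((fun ζ => F.eval ζ) '' ball (0 : ℂ) 1) →
      (F - C v).eval u ≠ 0 := by
    intro u hu v hv h
    rw [eval_sub, eval_C, sub_eq_zero] at h
    exact hv (subset_closure ⟨u, hu, h⟩)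
  have hlog : ∀ u ∈ ball (0 : ℂ) 1, ∀ v,
      v ∉ closure ((fun ζ => F.eval ζ) '' ball (0 : ℂ) 1) →
      F.derivative.eval u / (F.eval u - v) = ((F - C v).roots.map fun a => 1 / (u - a)).sum := by
    intro u hu v hv
    rw [← (IsAlgClosed.splits (F - C v)).eval_derivative_div_eval_of_ne_zero (hmem u hu v hv)]
    simp
  have hleft : expTransform ((fun ζ => F.eval ζ) '' ball (0 : ℂ) 1) z w =
      ((F - C z).roots.map fun a =>
        ((F - C w).roots.map fun b => 1 - 1 / (a * conj b)).prod).prod := by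
    rw [expTransform, setIntegral_polynomial_image measurableSet_ball hinj,
      ← exp_integral_unitBall_sum_mul_conj_sum (one_lt_norm_of_mem_roots_sub_C hz)
        (one_lt_norm_of_mem_roots_sub_C hw)]
    congr 2
    refine setIntegral_congr_fun measurableSet_ball fun u hu => ?_
    simp only [← hlog u hu z hz, ← hlog u hu w hw, map_div₀]
    rw [div_mul_div_comm, div_eq_mul_inv]
  have hcard : F.natDegree = Multiset.card (F - C z).roots := by
    rw [← (IsAlgClosed.splits (F - C z)).natDegree_eq_card_roots, natDegree_sub_C]
  have hw0 : conj (F.eval 0) - conj w ≠ 0 := by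
    have := hmem 0 (by simp) w hw
    rw [← map_sub, Ne, map_eq_zero]
    simpa using this
  have hfactor : ∀ a ∈ (F - C z).roots,
      conj (F.eval (1 / conj a)) - conj w =
        (conj (F.eval 0) - conj w) *
          ((F - C w).roots.map fun b => 1 - 1 / (a * conj b)).prod := by
    intro a ha
    have heval : ∀ x, conj (F.eval x) - conj w = conj (F - C w).leadingCoeff *
        ((F - C w).roots.map fun b => conj x - conj b).prod := by
      intro x
      rw [← map_sub, show F.eval x - w = (F - C w).eval x by simp,
        (IsAlgClosed.splits (F - C w)).eval_eq_prod_roots, map_mul, map_multiset_prod,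
        Multiset.map_map]
      simp
    rw [heval, heval, mul_assoc, ← Multiset.prod_map_mul]
    congr 2
    refine Multiset.map_congr rfl fun b hb => ?_
    have ha0 : a ≠ 0 := by
      rw [← norm_pos_iff]; linarith [one_lt_norm_of_mem_roots_sub_C hz a ha]
    have hb0 : conj b ≠ 0 := by
      rw [Ne, map_eq_zero, ← Ne, ← norm_pos_iff]
      linarith [one_lt_norm_of_mem_roots_sub_C hw b hb]
    simp only [map_div₀, map_one, map_zero, Complex.conj_conj]
    field_simp
    ring
  rw [hleft, Multiset.map_congr rfl hfactor, Multiset.prod_map_mul, Multiset.map_const',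
    Multiset.prod_replicate, ← hcard, mul_div_cancel_left₀ _ (pow_ne_zero _ hw0)]
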